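/- For each k = 2,…,m and all z ∈ ℂ∖(Δ₁ ∪ ⋯ ∪ Δ_m), one has R_{n,k}(z) = (−1)^{k−1} Φ_{n,k}(z) + Σ_{l=1}^{k−1} (−1)^{l−1} ϑ̂_{l,k}(z) Φ_{n,l}(z), where Φ_{n,k}(z) = ∫ R_n(x)/(z−x) ds_k(x), ϑ_{l,k} = ⟨σ_k, σ_{k−1}, …, σ_{l+1}⟩, and ϑ̂_{l,k}(z) = ∫ dϑ_{l,k}(t)/(z−t). -/

import Mathlib

open MeasureTheory Polynomial Filter Set Metric

/-- The (closed) support of a Borel measure on `ℝ`. -/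
def msupport (μ : MeasureTheory.Measure ℝ) : Set ℝ :=
  {x | ∀ ε > 0, 0 < μ (Metric.ball x ε)}

/-- The smallest closed interval containing the support of `μ`. -/
noncomputable def ihull (μ : MeasureTheory.Measure ℝ) : Set ℝ :=
  Set.Icc (sInf (msupport μ)) (sSup (msupport μ))

/-- The support of a measure viewed inside `ℂ`. -/
def csupp (μ : MeasureTheory.Measure ℝ) : Set ℂ :=
  Complex.ofReal '' msupport μ

/-- Density (with respect to `μ a`) of the Nikishin measure
`⟨w_a μ_a, w_{a+1} μ_{a+1}, …, w_{a+r} μ_{a+r}⟩`:  for `r = 0` it is just the weight `w a`,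
and inductively it is `w a` times the Cauchy transform of the inner system. -/
noncomputable def nikD (μ : ℕ → MeasureTheory.Measure ℝ) (w : ℕ → ℝ → ℂ) : ℕ → ℕ → ℝ → ℂ
  | a, 0 => w a
  | a, r + 1 => fun x =>
      w a x * ∫ t, nikD μ w (a + 1) r t / ((x : ℂ) - (t : ℂ)) ∂(μ (a + 1))

/-- Integral of `f` against the `k`-th measure (0-indexed) of the Nikishin system generated
by the weighted measures `w_j μ_j`. -/
noncomputable def nikInt (μ : ℕ → MeasureTheory.Measure ℝ) (w : ℕ → ℝ → ℂ) (k : ℕ)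
    (f : ℝ → ℂ) : ℂ :=
  ∫ x, f x * nikD μ w 0 k x ∂(μ 0)

/-- The multiple orthogonality relations for the multi-index `n` (0-indexed). -/
def OrthRel (μ : ℕ → MeasureTheory.Measure ℝ) (w : ℕ → ℝ → ℂ) (m : ℕ) (n : ℕ → ℕ)
    (Q : Polynomial ℂ) : Prop :=
  ∀ k < m, ∀ ν < n k, nikInt μ w k (fun x => (x : ℂ) ^ ν * Q.eval (x : ℂ)) = 0

/-- `Q` is a monic multiple orthogonal polynomial of smallest degree for the Nikishin system
generated by the weighted measures `w_j μ_j` and the multi-index `n`. -/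
def IsLeastMOP (μ : ℕ → MeasureTheory.Measure ℝ) (w : ℕ → ℝ → ℂ) (m : ℕ) (n : ℕ → ℕ)
    (Q : Polynomial ℂ) : Prop :=
  Q.Monic ∧ OrthRel μ w m n Q ∧
    ∀ Q' : Polynomial ℂ, Q'.Monic → OrthRel μ w m n Q' → Q.natDegree ≤ Q'.natDegree

/-- The second type functions: `psiFun μ w Q 0 = Q` and
`psiFun μ w Q (k+1) z = ∫ psiFun μ w Q k (x) · w k x / (z - x) dμ_k(x)`. -/
noncomputable def psiFun (μ : ℕ → MeasureTheory.Measure ℝ) (w : ℕ → ℝ → ℂ)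
    (Q : Polynomial ℂ) : ℕ → ℂ → ℂ
  | 0 => fun z => Q.eval z
  | k + 1 => fun z => ∫ x, psiFun μ w Q k (x : ℂ) * w k x / (z - (x : ℂ)) ∂(μ k)

/-- A system of `m` finite Borel measures with compact support on `ℝ`, each of constant
sign (`ς k ∈ {1,-1}`), whose interval hulls `Δ_k` are consecutively disjoint:
the generator of a Nikishin system. -/
structure NikSys (m : ℕ) where
  μ : ℕ → MeasureTheory.Measure ℝ
  ς : ℕ → ℝ
  hsign : ∀ k < m, ς k = 1 ∨ ς k = -1
  hfin : ∀ k < m, MeasureTheory.IsFiniteMeasure (μ k)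
  hcpt : ∀ k < m, IsCompact (msupport (μ k))
  hne : ∀ k < m, (msupport (μ k)).Nonempty
  hdisj : ∀ k, k + 1 < m → ihull (μ k) ∩ ihull (μ (k + 1)) = ∅

/-- The weights of the unperturbed system: just the signs. -/
def NikSys.w {m : ℕ} (S : NikSys m) : ℕ → ℝ → ℂ := fun k _ => (S.ς k : ℂ)

/-- The weights of the system perturbed by the polynomials `p`. -/
noncomputable def polyW {m : ℕ} (S : NikSys m) (p : ℕ → Polynomial ℂ) : ℕ → ℝ → ℂ :=
  fun k x => (S.ς k : ℂ) * (p k).eval (x : ℂ)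

/-- The weights of the system perturbed by the rational functions `p/q`. -/
noncomputable def ratW {m : ℕ} (S : NikSys m) (p q : ℕ → Polynomial ℂ) : ℕ → ℝ → ℂ :=
  fun k x => (S.ς k : ℂ) * (p k).eval (x : ℂ) / (q k).eval (x : ℂ)

/-- Monic polynomials whose zeros lie in `ℂ ∖ ⋃_{k<m} Δ_k`. -/
def GoodPolys (m : ℕ) (S : NikSys m) (p : ℕ → Polynomial ℂ) : Prop :=
  (∀ k < m, (p k).Monic) ∧
    ∀ k < m, ∀ z : ℂ, (p k).IsRoot z → ∀ i < m, z ∉ Complex.ofReal '' ihull (S.μ i)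

/-- A Nikishin generator of class `N^*`: the support of `σ_k` consists of an interval
`Δ̃_k = [a_k, b_k]` on which `|σ_k'| > 0` a.e., together with a discrete set without
accumulation points in `ℝ ∖ Δ̃_k`. -/
structure NikStar (m : ℕ) extends NikSys m where
  a : ℕ → ℝ
  b : ℕ → ℝ
  hab : ∀ k < m, a k < b k
  hsub : ∀ k < m, Set.Icc (a k) (b k) ⊆ msupport (μ k)
  hdisc : ∀ k < m, ∀ x ∉ Set.Icc (a k) (b k),
    ¬ AccPt x (Filter.principal (msupport (μ k)))
  hac : ∀ k < m,
    ∀ᵐ x ∂(MeasureTheory.volume.restrict (Set.Icc (a k) (b k))),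
      0 < (μ k).rnDeriv MeasureTheory.volume x

/-- The multi-index class `ℤ₊^m(⊛; p₁,…,p_m)` (0-indexed). -/
def StarIdx (m : ℕ) (p : ℕ → Polynomial ℂ) (n : ℕ → ℕ) : Prop :=
  (∀ k, m ≤ k → n k = 0) ∧
    ∀ j k : ℕ, j < k → k < m →
      n k + ∑ i ∈ Finset.Ioc j k, (p i).natDegree ≤ n j + 1

/-- The multi-index class `ℤ₊^m(⊛)` (0-indexed). -/
def CircIdx (m : ℕ) (n : ℕ → ℕ) : Prop :=
  (∀ k, m ≤ k → n k = 0) ∧ ∀ j k : ℕ, j < k → k < m → n k ≤ n j + 1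

/-- `|n| = n₁ + ⋯ + n_m`. -/
def mnorm (m : ℕ) (n : ℕ → ℕ) : ℕ := ∑ k ∈ Finset.range m, n k

/-- Uniform convergence, on every compact subset of `U`, of the functions `f n`
to `F` as `|n| → ∞` through `Λ`. -/
def UnifLimOn (m : ℕ) (Λ : Set ((ℕ → ℕ))) (f : (ℕ → ℕ) → ℂ → ℂ) (F : ℂ → ℂ)
    (U : Set ℂ) : Prop :=
  ∀ K : Set ℂ, K ⊆ U → IsCompact K → ∀ ε > 0, ∃ N : ℕ, ∀ n ∈ Λ, N ≤ mnorm m n →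
    ∀ z ∈ K, dist (f n z) (F z) < ε

/-- `F` is analytic and nowhere vanishing on `U` and has a finite nonzero limit at `∞`. -/
def GoodLimit (F : ℂ → ℂ) (U : Set ℂ) : Prop :=
  DifferentiableOn ℂ F U ∧ (∀ z ∈ U, F z ≠ 0) ∧
    ∃ c : ℂ, c ≠ 0 ∧ Filter.Tendsto F (Bornology.cobounded ℂ) (nhds c)

/-- The Cauchy transform `z ↦ ∫ h(t) / (z - t) dμ(t)`. -/
noncomputable def cauchyT (μ : Measure ℝ) (h : ℝ → ℂ) (z : ℂ) : ℂ :=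
  ∫ t, h t / (z - (t : ℂ)) ∂μ

/-- Iterated Cauchy transforms of `f`, starting with the measure `w a * μ a`. -/
noncomputable def cauchyIter (μ : ℕ → Measure ℝ) (w : ℕ → ℝ → ℂ) (f : ℝ → ℂ) (a : ℕ) :
    ℕ → ℂ → ℂ
  | 0 => cauchyT (μ a) fun x => f x * w a x
  | r + 1 => cauchyT (μ (a + r + 1)) fun x => cauchyIter μ w f a r (x : ℂ) * w (a + r + 1) x

/-- Strongly measurable functions that are bounded on the convex hull of the support of `μ`. -/
def BddMeas (μ : Measure ℝ) (f : ℝ → ℂ) : Prop :=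
  StronglyMeasurable f ∧ ∃ C, ∀ x ∈ ihull μ, ‖f x‖ ≤ C

theorem measure_compl_msupport (μ : Measure ℝ) : μ (msupport μ)ᶜ = 0 := by
  refine measure_null_of_locally_null _ fun x hx => ?_
  simp only [msupport, mem_compl_iff, mem_ofPred_eq, not_forall, not_lt, nonpos_iff_eq_zero] at hx
  obtain ⟨ε, hε, h⟩ := hx
  exact ⟨ball x ε, mem_nhdsWithin_of_mem_nhds (ball_mem_nhds x hε), h⟩

theorem ae_mem_ihull {μ : Measure ℝ} (h : IsCompact (msupport μ)) : ∀ᵐ x ∂μ, x ∈ ihull μ := by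
  have h0 : ∀ᵐ x ∂μ, x ∈ msupport μ := measure_compl_msupport μ
  filter_upwards [h0] with x hx
  exact ⟨csInf_le h.bddBelow hx, le_csSup h.bddAbove hx⟩

theorem BddMeas.mul {μ : Measure ℝ} {f g : ℝ → ℂ} (hf : BddMeas μ f) (hg : BddMeas μ g) :
    BddMeas μ fun x => f x * g x := by
  obtain ⟨hfm, C, hC⟩ := hf
  obtain ⟨hgm, D, hD⟩ := hg
  refine ⟨hfm.mul hgm, C * D, fun x hx => ?_⟩
  rw [norm_mul]
  exact mul_le_mul (hC x hx) (hD x hx) (norm_nonneg _) ((norm_nonneg _).trans (hC x hx))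

theorem bddMeas_of_continuous (μ : Measure ℝ) {f : ℝ → ℂ} (hf : Continuous f) : BddMeas μ f :=
  ⟨hf.stronglyMeasurable, isCompact_Icc.exists_bound_of_continuousOn hf.continuousOn⟩

theorem BddMeas.integrable {μ : Measure ℝ} [IsFiniteMeasure μ] (hμ : IsCompact (msupport μ))
    {f : ℝ → ℂ} (hf : BddMeas μ f) : Integrable f μ := by
  obtain ⟨hfm, C, hC⟩ := hf
  refine Integrable.of_bound hfm.aestronglyMeasurable C ?_
  filter_upwards [ae_mem_ihull hμ] with x hx using hC x hx

theorem exists_bound_inv_sub {I J : Set ℝ} (hI : IsCompact I) (hJ : IsCompact J)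
    (h : I ∩ J = ∅) : ∃ C, ∀ x ∈ I, ∀ y ∈ J, ‖((x : ℂ) - y)⁻¹‖ ≤ C := by
  have hc : ContinuousOn (fun q : ℝ × ℝ => ((q.1 : ℂ) - q.2)⁻¹) (I ×ˢ J) := by
    refine ContinuousOn.inv₀ (by fun_prop) ?_
    rintro ⟨x, y⟩ ⟨hx, hy⟩ h0
    have hxy : x = y := by simpa [sub_eq_zero] using h0
    have hmem : x ∈ I ∩ J := ⟨hx, hxy ▸ hy⟩
    simp [h] at hmem
  obtain ⟨C, hC⟩ := (hI.prod hJ).exists_bound_of_continuousOn hc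
  exact ⟨C, fun x hx y hy => hC (x, y) ⟨hx, hy⟩⟩

theorem bddMeas_inv_sub {μ : Measure ℝ} {z : ℂ} (hz : z ∉ Complex.ofReal '' ihull μ) :
    BddMeas μ fun x => (z - (x : ℂ))⁻¹ := by
  refine ⟨Measurable.stronglyMeasurable (by fun_prop),
    isCompact_Icc.exists_bound_of_continuousOn (ContinuousOn.inv₀ (by fun_prop) ?_)⟩
  intro x hx h0
  exact hz ⟨x, hx, (sub_eq_zero.mp h0).symm⟩

theorem BddMeas.cauchyT {μ ν : Measure ℝ} [IsFiniteMeasure μ] (hμ : IsCompact (msupport μ))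
    (hd : ihull ν ∩ ihull μ = ∅) {h : ℝ → ℂ} (hh : BddMeas μ h) :
    BddMeas ν fun x => cauchyT μ h x := by
  obtain ⟨hm, C, hC⟩ := hh
  obtain ⟨D, hD⟩ := exists_bound_inv_sub (I := ihull ν) (J := ihull μ)
    isCompact_Icc isCompact_Icc hd
  have hmm := hm.measurable
  constructor
  · have hmeas : StronglyMeasurable
        (Function.uncurry fun (x t : ℝ) => h t / ((x : ℂ) - (t : ℂ))) := by
      refine Measurable.stronglyMeasurable ?_
      simp only [Function.uncurry_def]
      fun_prop
    exact hmeas.integral_prod_right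
  · refine ⟨C * D * μ.real univ, fun x hx => norm_integral_le_of_norm_le_const ?_⟩
    filter_upwards [ae_mem_ihull hμ] with t ht
    rw [div_eq_mul_inv, norm_mul]
    exact mul_le_mul (hC t ht) (hD x hx t ht) (norm_nonneg _) ((norm_nonneg _).trans (hC t ht))

/-- The Cauchy transform of a product of one function with the Cauchy transform of another. -/
theorem cauchyT_mul_cauchyT {μ ν : Measure ℝ} [IsFiniteMeasure μ] [IsFiniteMeasure ν]
    (hμ : IsCompact (msupport μ)) (hν : IsCompact (msupport ν)) (hd : ihull μ ∩ ihull ν = ∅)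
    {g h : ℝ → ℂ} (hg : BddMeas μ g) (hh : BddMeas ν h) {z : ℂ}
    (hzμ : z ∉ Complex.ofReal '' ihull μ) (hzν : z ∉ Complex.ofReal '' ihull ν) :
    cauchyT ν (fun y => cauchyT μ g y * h y) z =
      cauchyT μ g z * cauchyT ν h z - cauchyT μ (fun x => g x * cauchyT ν h x) z := by
  have hG := hg.mul (bddMeas_inv_sub hzμ)
  have hH := hh.mul (bddMeas_inv_sub hzν)
  obtain ⟨D, hD⟩ := exists_bound_inv_sub (I := ihull μ) (J := ihull ν)
    isCompact_Icc isCompact_Icc hd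
  have hint : Integrable (Function.uncurry fun (y x : ℝ) =>
      g x / ((y : ℂ) - x) * h y / (z - y)) (ν.prod μ) := by
    obtain ⟨hgm, A, hA⟩ := hg
    obtain ⟨hHm, B, hB⟩ := hH
    have hgm' := hgm.measurable
    have hhm' := hh.1.measurable
    refine Integrable.of_bound (C := A * D * B) ?_ ?_
    · refine Measurable.aestronglyMeasurable ?_
      simp only [Function.uncurry_def]
      fun_prop
    · filter_upwards [Measure.quasiMeasurePreserving_fst.ae (ae_mem_ihull hν),
        Measure.quasiMeasurePreserving_snd.ae (ae_mem_ihull hμ)] with q hq1 hq2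
      have e : Function.uncurry (fun (y x : ℝ) => g x / ((y : ℂ) - x) * h y / (z - y)) q =
          g q.2 * ((q.1 : ℂ) - q.2)⁻¹ * (h q.1 * (z - q.1)⁻¹) := by
        simp only [Function.uncurry_def]
        ring
      have hsub : ‖((q.1 : ℂ) - q.2)⁻¹‖ ≤ D := by
        rw [norm_inv, norm_sub_rev, ← norm_inv]
        exact hD _ hq2 _ hq1
      have hA' := hA _ hq2
      have hB' := hB _ hq1
      have hA0 := (norm_nonneg _).trans hA'
      have hD0 := (norm_nonneg _).trans hsub
      rw [e, norm_mul, norm_mul]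
      gcongr
  have hleft : cauchyT ν (fun y => cauchyT μ g y * h y) z =
      ∫ y : ℝ, ∫ x : ℝ, g x / ((y : ℂ) - x) * h y / (z - y) ∂μ ∂ν := by
    simp only [cauchyT, integral_mul_const, integral_div]
  have hinner : ∀ᵐ x ∂μ, ∫ y : ℝ, g x / ((y : ℂ) - x) * h y / (z - y) ∂ν =
      g x / (z - x) * cauchyT ν h z - g x * cauchyT ν h x / (z - x) := by
    filter_upwards [ae_mem_ihull hμ] with x hx
    have hx' : (x : ℂ) ∉ Complex.ofReal '' ihull ν := by
      rintro ⟨y, hy, hyx⟩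
      have hyx' : y = x := by exact_mod_cast hyx
      have hmem : x ∈ ihull μ ∩ ihull ν := ⟨hx, hyx' ▸ hy⟩
      simp [hd] at hmem
    have i1 := (hH.integrable hν).const_mul (g x / (z - x))
    have i2 := ((hh.mul (bddMeas_inv_sub hx')).integrable hν).const_mul (g x / (z - x))
    have hpt : ∀ᵐ y : ℝ ∂ν, g x / ((y : ℂ) - x) * h y / (z - y) =
        g x / (z - x) * (h y * (z - y)⁻¹) - g x / (z - x) * (h y * ((x : ℂ) - y)⁻¹) := by
      filter_upwards [ae_mem_ihull hν] with y hy
      have h1 : z - (x : ℂ) ≠ 0 := fun h0 => hzμ ⟨x, hx, (sub_eq_zero.mp h0).symm⟩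
      have h2 : z - (y : ℂ) ≠ 0 := fun h0 => hzν ⟨y, hy, (sub_eq_zero.mp h0).symm⟩
      have h3 : (x : ℂ) - y ≠ 0 := fun h0 => hx' ⟨y, hy, (sub_eq_zero.mp h0).symm⟩
      have h4 : (y : ℂ) - x = -((x : ℂ) - y) := by ring
      rw [h4]
      field_simp
      ring
    rw [integral_congr_ae hpt, integral_sub i1 i2, integral_const_mul, integral_const_mul]
    simp only [cauchyT, div_eq_mul_inv]
    ring
  have j1 := (hG.integrable hμ).mul_const (cauchyT ν h z)
  have j2 := ((hg.mul (hh.cauchyT hν hd)).mul (bddMeas_inv_sub hzμ)).integrable hμ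
  simp only [← div_eq_mul_inv] at j1 j2
  rw [hleft, integral_integral_swap hint, integral_congr_ae hinner, integral_sub j1 j2,
    integral_mul_const]
  rfl

theorem cauchyIter_succ (μ : ℕ → Measure ℝ) (w : ℕ → ℝ → ℂ) (f : ℝ → ℂ) (a r : ℕ) :
    cauchyIter μ w f a (r + 1) =
      cauchyIter μ w (fun x => cauchyT (μ a) (fun t => f t * w a t) x) (a + 1) r := by
  induction r with
  | zero => rfl
  | succ r ih =>
    rw [cauchyIter, ih, cauchyIter, show a + (r + 1) + 1 = a + 1 + r + 1 by omega]

theorem psiFun_succ_eq_cauchyIter (μ : ℕ → Measure ℝ) (w : ℕ → ℝ → ℂ) (Q : Polynomial ℂ) (k : ℕ) :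
    psiFun μ w Q (k + 1) = cauchyIter μ w (fun x => Q.eval (x : ℂ)) 0 k := by
  induction k with
  | zero => rfl
  | succ k ih =>
    rw [psiFun, ih, cauchyIter, show 0 + k + 1 = k + 1 by omega]
    rfl

theorem nikD_succ_left (μ : ℕ → Measure ℝ) (w : ℕ → ℝ → ℂ) (a r : ℕ) :
    nikD μ w (a + 1) r = nikD (fun j => μ (j + 1)) (fun j => w (j + 1)) a r := by
  induction r generalizing a with
  | zero => rfl
  | succ r ih => simp only [nikD, ih]

/-- Iterated Cauchy transforms of `1` are Cauchy transforms of the reversed Nikishin system. -/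
theorem cauchyIter_one (μ : ℕ → Measure ℝ) (w : ℕ → ℝ → ℂ) (b r : ℕ) :
    cauchyIter μ w (fun _ => 1) b r =
      cauchyT (μ (b + r)) (nikD (fun j => μ (b + r - j)) (fun j => w (b + r - j)) 0 r) := by
  induction r with
  | zero => simp [cauchyIter, nikD]
  | succ r ih =>
    rw [cauchyIter, ih]
    congr 1
    funext x
    simp only [nikD, nikD_succ_left, ← add_assoc, Nat.add_sub_add_right, Nat.sub_zero,
      zero_add, Nat.add_sub_cancel]
    rw [mul_comm]
    rfl

namespace NikSys

variable {m : ℕ} (S : NikSys m)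

theorem bddMeas_nikD (r a : ℕ) (h : a + r < m) : BddMeas (S.μ a) (nikD S.μ S.w a r) := by
  induction r generalizing a with
  | zero => exact bddMeas_of_continuous _ continuous_const
  | succ r ih =>
    have := S.hfin (a + 1) (by omega)
    exact (bddMeas_of_continuous _ continuous_const).mul
      ((ih (a + 1) (by omega)).cauchyT (S.hcpt _ (by omega)) (S.hdisj a (by omega)))

theorem cauchyIter_eq {z : ℂ} (hz : ∀ i < m, z ∉ Complex.ofReal '' ihull (S.μ i)) (r a : ℕ)
    (h : a + r < m) {f : ℝ → ℂ} (hf : BddMeas (S.μ a) f) :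
    cauchyIter S.μ S.w f a r z =
      (-1) ^ r * cauchyT (S.μ a) (fun x => f x * nikD S.μ S.w a r x) z +
        ∑ l ∈ Finset.range r, (-1) ^ l * cauchyIter S.μ S.w (fun _ => 1) (a + l + 1) (r - 1 - l) z *
          cauchyT (S.μ a) (fun x => f x * nikD S.μ S.w a l x) z := by
  induction r generalizing a f with
  | zero => simp [cauchyIter, nikD]
  | succ r ih =>
    have hd := S.hdisj a (by omega)
    have hca := S.hcpt a (by omega)
    have hcb := S.hcpt (a + 1) (by omega)
    have := S.hfin a (by omega)
    have := S.hfin (a + 1) (by omega)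
    have hfw : BddMeas (S.μ a) fun t => f t * S.w a t :=
      hf.mul (bddMeas_of_continuous _ continuous_const)
    have hstep : ∀ l ≤ r, cauchyT (S.μ (a + 1)) (fun y =>
        cauchyT (S.μ a) (fun t => f t * S.w a t) y * nikD S.μ S.w (a + 1) l y) z =
        cauchyT (S.μ a) (fun t => f t * S.w a t) z *
          cauchyT (S.μ (a + 1)) (nikD S.μ S.w (a + 1) l) z -
          cauchyT (S.μ a) (fun x => f x * nikD S.μ S.w a (l + 1) x) z := by
      intro l hl
      rw [cauchyT_mul_cauchyT hca hcb hd hfw (S.bddMeas_nikD l (a + 1) (by omega))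
        (hz _ (by omega)) (hz _ (by omega))]
      simp only [mul_assoc]
      rfl
    have hg := hfw.cauchyT hca ((inter_comm _ _).trans hd)
    have h1 := ih (a + 1) (by omega)
      (bddMeas_of_continuous (S.μ (a + 1)) (continuous_const (y := (1 : ℂ))))
    rw [cauchyIter_succ, ih (a + 1) (by omega) hg, hstep r le_rfl, Finset.sum_range_succ']
    simp only [one_mul] at h1
    have hsum : ∀ l ∈ Finset.range r,
        (-1 : ℂ) ^ l * cauchyIter S.μ S.w (fun _ => 1) (a + 1 + l + 1) (r - 1 - l) z *
          cauchyT (S.μ (a + 1)) (fun y =>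
            cauchyT (S.μ a) (fun t => f t * S.w a t) y * nikD S.μ S.w (a + 1) l y) z =
        cauchyT (S.μ a) (fun t => f t * S.w a t) z *
          ((-1 : ℂ) ^ l * cauchyIter S.μ S.w (fun _ => 1) (a + 1 + l + 1) (r - 1 - l) z *
            cauchyT (S.μ (a + 1)) (nikD S.μ S.w (a + 1) l) z) +
        (-1 : ℂ) ^ (l + 1) *
          cauchyIter S.μ S.w (fun _ => 1) (a + (l + 1) + 1) (r + 1 - 1 - (l + 1)) z *
            cauchyT (S.μ a) (fun x => f x * nikD S.μ S.w a (l + 1) x) z := by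
      intro l hl
      rw [hstep l (Finset.mem_range.mp hl).le, show a + (l + 1) + 1 = a + 1 + l + 1 by omega,
        show r + 1 - 1 - (l + 1) = r - 1 - l by omega]
      ring
    rw [Finset.sum_congr rfl hsum, Finset.sum_add_distrib, ← Finset.mul_sum]
    simp only [add_zero, Nat.add_sub_cancel, Nat.sub_zero, pow_zero, one_mul, h1]
    simp only [nikD]
    ring

end NikSys

/-- For `k = 2,…,m` and `z ∈ ℂ ∖ (Δ₁ ∪ ⋯ ∪ Δ_m)`,
`R_{n,k}(z) = (-1)^{k-1} Φ_{n,k}(z) + ∑_{l=1}^{k-1} (-1)^{l-1} ϑ̂_{l,k}(z) Φ_{n,l}(z)`. -/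
theorem R_functions_decomposition
    (m : ℕ) (hm : 0 < m) (S : NikSys m) (p : ℕ → Polynomial ℂ) (hp : GoodPolys m S p)
    (n : ℕ → ℕ) (hn : StarIdx m p n)
    (Qt : Polynomial ℂ) (hQt : IsLeastMOP S.μ (polyW S p) m n Qt)
    (R : Polynomial ℂ) (hR : R = Qt * ∏ i ∈ Finset.range m, p i)
    -- `Φ j` is the function `Φ_{n,j+1}(z) = ∫ R_n(x)/(z-x) ds_{j+1}(x)` (0-indexed `j`)
    (Φ : ℕ → ℂ → ℂ)
    (hΦ : ∀ j : ℕ, ∀ z : ℂ, Φ j z =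
      ∫ x, R.eval (x : ℂ) / (z - (x : ℂ)) * nikD S.μ S.w 0 j x ∂(S.μ 0))
    -- `θ l k` is the Cauchy transform `ϑ̂_{l,k}` of `ϑ_{l,k} = ⟨σ_k, σ_{k-1}, …, σ_{l+1}⟩`
    (θ : ℕ → ℕ → ℂ → ℂ)
    (hθ : ∀ l k : ℕ, ∀ z : ℂ, θ l k z =
      ∫ t, nikD (fun j => S.μ (k - 1 - j)) (fun j => S.w (k - 1 - j)) 0 (k - 1 - l) t /
          (z - (t : ℂ)) ∂(S.μ (k - 1))) :
    ∀ k : ℕ, 2 ≤ k → k ≤ m →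
      ∀ z : ℂ, (∀ i < m, z ∉ Complex.ofReal '' ihull (S.μ i)) →
        psiFun S.μ S.w R k z =
          (-1 : ℂ) ^ (k - 1) * Φ (k - 1) z +
            ∑ l ∈ Finset.Ico 1 k, (-1 : ℂ) ^ (l - 1) * θ l k z * Φ (l - 1) z := by
  rintro k hk hkm z hz
  obtain ⟨r, rfl⟩ : ∃ r, k = r + 1 := ⟨k - 1, by omega⟩
  have hΦ' : ∀ j, Φ j z =
      cauchyT (S.μ 0) (fun x => R.eval (x : ℂ) * nikD S.μ S.w 0 j x) z := by
    intro j
    rw [hΦ, cauchyT]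
    congr 1
    funext x
    ring
  rw [psiFun_succ_eq_cauchyIter, S.cauchyIter_eq hz r 0 (by omega)
    (bddMeas_of_continuous _ (by fun_prop)), Finset.sum_Ico_eq_sum_range]
  simp only [Nat.add_sub_cancel, hΦ', Nat.add_sub_cancel_left]
  congr 1
  refine Finset.sum_congr rfl fun l hl => ?_
  have hl' := Finset.mem_range.mp hl
  rw [cauchyIter_one, hθ, show 0 + l + 1 + (r - 1 - l) = r by omega,
    show r + 1 - 1 = r by omega, show r - (1 + l) = r - 1 - l by omega]
  rfl
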